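/- arXiv:1412.7293 — 5 statements merged into one kernel-verified Lean document; each statement's English description precedes it below -/
import Mathlib

section
/- Let w and d be pure quaternions (real part zero) in the quaternions ℍ, let ρ ∈ ℝ, and assume q := ρ + d ≠ 0. Then q·w·q⁻¹ is again a pure quaternion, ‖q·w·q⁻¹‖ = ‖w‖, and ‖q·w·q⁻¹ + d‖ = ‖w + d‖. Consequently, the quadrilateral with vertices g, g₁ := g + w, g₂ := g₁ + d, g₁₂ := g₂ + q·w·q⁻¹ (for any g ∈ Im ℍ ≅ ℝ³) is a skew parallelogram: opposite sides have equal lengths ‖g₁₂ − g₂‖ = ‖g₁ − g‖ and ‖g₁₂ − g₁‖ = ‖g₂ − g‖. -/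
open scoped Quaternion

noncomputable section

/-- Conjugation of a pure quaternion w by q = ρ + d (d pure) yields a pure
quaternion of the same norm with ‖q w q⁻¹ + d‖ = ‖w + d‖; hence the quad
g, g + w, g + w + d, g + w + d + q w q⁻¹ is a skew parallelogram. -/
theorem skew_parallelogram_from_rotation
    (w d : ℍ[ℝ]) (hw : w.re = 0) (hd : d.re = 0) (ρ : ℝ)
    (hq : (ρ : ℍ[ℝ]) + d ≠ 0) (g : ℍ[ℝ]) (hg : g.re = 0) :
    (((ρ : ℍ[ℝ]) + d) * w * ((ρ : ℍ[ℝ]) + d)⁻¹).re = 0 ∧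
    ‖((ρ : ℍ[ℝ]) + d) * w * ((ρ : ℍ[ℝ]) + d)⁻¹‖ = ‖w‖ ∧
    ‖((ρ : ℍ[ℝ]) + d) * w * ((ρ : ℍ[ℝ]) + d)⁻¹ + d‖ = ‖w + d‖ ∧
    (let g₁ : ℍ[ℝ] := g + w
     let g₂ : ℍ[ℝ] := g₁ + d
     let g₁₂ : ℍ[ℝ] := g₂ + ((ρ : ℍ[ℝ]) + d) * w * ((ρ : ℍ[ℝ]) + d)⁻¹
     ‖g₁₂ - g₂‖ = ‖g₁ - g‖ ∧ ‖g₁₂ - g₁‖ = ‖g₂ - g‖) := by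
  have hre : ∀ a b : ℍ[ℝ], (a * b).re = (b * a).re := by
    intro a b
    simp only [Quaternion.re_mul]
    ring
  have hcomm : ((ρ : ℍ[ℝ]) + d) * d = d * ((ρ : ℍ[ℝ]) + d) := by
    rw [add_mul, mul_add, (Quaternion.coe_commutes ρ d)]
  generalize (ρ : ℍ[ℝ]) + d = q at hq hcomm ⊢
  have hnorm : ∀ x : ℍ[ℝ], ‖q * x * q⁻¹‖ = ‖x‖ := by
    intro x
    have : ‖q‖ ≠ 0 := norm_ne_zero_iff.mpr hq
    rw [norm_mul, norm_mul, norm_inv]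
    field_simp
  have h3 : ‖q * w * q⁻¹ + d‖ = ‖w + d‖ := by
    rw [← hnorm (w + d), mul_add, add_mul, hcomm, mul_inv_cancel_right₀ hq]
  refine ⟨?_, hnorm w, h3, ?_, ?_⟩
  · rw [hre, inv_mul_cancel_left₀ hq, hw]
  · rw [add_sub_cancel_left, add_sub_cancel_left, hnorm]
  · rw [show g + w + d + q * w * q⁻¹ - (g + w) = q * w * q⁻¹ + d by abel,
      show g + w + d - g = w + d by abel, h3]
end
end

section
/- Let n be a pure unit quaternion and let φ ∈ ℍ be a nonzero quaternion with imaginary part v := Im φ. Define n₁ := −φ⁻¹·n·φ. Then n₁ is a pure unit quaternion and the edge-constraint holds for the edge vector v: the vector v ∈ ℝ³ is orthogonal to Im(n) + Im(n₁), i.e., Re(v·(n + n₁)) = 0 in ℍ. -/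
open scoped Quaternion

noncomputable section

/-- A normal transport quaternion φ produces from a pure unit normal n a pure
unit normal n₁ = −φ⁻¹ n φ satisfying the edge-constraint with the edge
vector v = Im φ. -/
theorem normal_transport_edge_constraint
    (n φ : ℍ[ℝ]) (hn : n.re = 0) (hnu : ‖n‖ = 1) (hφ : φ ≠ 0) :
    (-(φ⁻¹ * n * φ)).re = 0 ∧
    ‖-(φ⁻¹ * n * φ)‖ = 1 ∧
    (φ.im * (n + -(φ⁻¹ * n * φ))).re = 0 := by
  have hc : ∀ a b : ℍ[ℝ], (a * b).re = (b * a).re := by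
    intro a b
    simp only [Quaternion.re_mul]
    ring
  have h1 : (-(φ⁻¹ * n * φ)).re = 0 := by
    rw [Quaternion.re_neg, hc, ← mul_assoc, mul_inv_cancel₀ hφ, one_mul, hn, neg_zero]
  have hp : ‖φ‖ ≠ 0 := norm_ne_zero_iff.mpr hφ
  refine ⟨h1, ?_, ?_⟩
  · rw [norm_neg, norm_mul, norm_mul, norm_inv, hnu, mul_one, inv_mul_cancel₀ hp]
  · have him : φ.im = φ - (φ.re : ℍ[ℝ]) := by
      rw [eq_sub_iff_add_eq, add_comm, Quaternion.re_add_im]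
    have h2 : φ * (n + -(φ⁻¹ * n * φ)) = φ * n - n * φ := by
      rw [mul_add, mul_neg, ← mul_assoc, ← mul_assoc, mul_inv_cancel₀ hφ, one_mul,
        sub_eq_add_neg]
    rw [him, sub_mul, h2, Quaternion.re_sub, Quaternion.re_sub, hc φ n, sub_self,
      Quaternion.coe_mul_eq_smul, Quaternion.re_smul, Quaternion.re_add, hn, h1]
    simp
end
end

section
/- Let n and n₁ be pure unit quaternions, let φ, λ, λ₁ ∈ ℍ be nonzero quaternions, and suppose the edge-constraint relation n₁ = −φ⁻¹·n·φ holds. Define the spin-transformed data ñ := λ⁻¹·n·λ, ñ₁ := λ₁⁻¹·n₁·λ₁, and φ̃ := (conj λ)·φ·λ₁, where conj denotes quaternionic conjugation. Then ñ and ñ₁ are pure unit quaternions, φ̃ ≠ 0, and the edge-constraint relation is preserved: ñ₁ = −φ̃⁻¹·ñ·φ̃. -/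
open scoped Quaternion

noncomputable section

theorem quat_re_mul_comm (a b : ℍ[ℝ]) : (a * b).re = (b * a).re := by
  simp only [Quaternion.re_mul]
  ring

theorem quat_conj_re (l n : ℍ[ℝ]) (hl : l ≠ 0) : (l⁻¹ * n * l).re = n.re := by
  rw [quat_re_mul_comm, ← mul_assoc, mul_inv_cancel₀ hl, one_mul]

theorem quat_conj_norm (l n : ℍ[ℝ]) (hl : l ≠ 0) : ‖l⁻¹ * n * l‖ = ‖n‖ := by
  have h : ‖l‖ ≠ 0 := norm_ne_zero_iff.mpr hl
  rw [norm_mul, norm_mul, norm_inv]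
  field_simp

/-- A discrete spin transformation preserves the edge-constraint relation:
if n₁ = −φ⁻¹ n φ then ñ₁ = −φ̃⁻¹ ñ φ̃ for ñ = λ⁻¹ n λ, ñ₁ = λ₁⁻¹ n₁ λ₁ and
φ̃ = (conj λ) φ λ₁. -/
theorem spin_transformation_preserves_edge_constraint
    (n n₁ φ lam lam₁ : ℍ[ℝ])
    (hn : n.re = 0) (hnu : ‖n‖ = 1) (hn₁ : n₁.re = 0) (hn₁u : ‖n₁‖ = 1)
    (hφ : φ ≠ 0) (hl : lam ≠ 0) (hl₁ : lam₁ ≠ 0)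
    (hedge : n₁ = -(φ⁻¹ * n * φ)) :
    (lam⁻¹ * n * lam).re = 0 ∧ ‖lam⁻¹ * n * lam‖ = 1 ∧
    (lam₁⁻¹ * n₁ * lam₁).re = 0 ∧ ‖lam₁⁻¹ * n₁ * lam₁‖ = 1 ∧
    star lam * φ * lam₁ ≠ 0 ∧
    lam₁⁻¹ * n₁ * lam₁ =
      -((star lam * φ * lam₁)⁻¹ * (lam⁻¹ * n * lam) * (star lam * φ * lam₁)) := by
  have hs : star lam ≠ 0 := star_ne_zero.mpr hl
  have hq : star lam * φ * lam₁ ≠ 0 := mul_ne_zero (mul_ne_zero hs hφ) hl₁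
  refine ⟨by rw [quat_conj_re _ _ hl, hn], by rw [quat_conj_norm _ _ hl, hnu],
    by rw [quat_conj_re _ _ hl₁, hn₁], by rw [quat_conj_norm _ _ hl₁, hn₁u], hq, ?_⟩
  have hc : n * (lam * star lam) = (lam * star lam) * n := by
    rw [Quaternion.self_mul_star]
    exact (Quaternion.coe_commutes _ _).symm
  have key : (star lam)⁻¹ * lam⁻¹ * n * lam * star lam = n := by
    rw [mul_assoc _ lam, mul_assoc _ n, hc, ← mul_inv_rev, ← mul_assoc,
      inv_mul_cancel₀ (mul_ne_zero hl hs), one_mul]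
  have e : (star lam * φ * lam₁)⁻¹ * (lam⁻¹ * n * lam) * (star lam * φ * lam₁)
      = lam₁⁻¹ * φ⁻¹ * ((star lam)⁻¹ * lam⁻¹ * n * lam * star lam) * φ * lam₁ := by
    simp only [mul_inv_rev, mul_assoc]
  rw [e, key, hedge]
  simp only [mul_neg, neg_mul, mul_assoc]
end
end

section
/- Let n and n₁ be pure unit quaternions with n ≠ n₁, let α ∈ ℝ, and set λ := cos(α/2) − sin(α/2)·n, λ₁ := cos(α/2) − sin(α/2)·n₁, and e := (n₁ − n)/‖n₁ − n‖² (a pure quaternion). Then the imaginary part of the spin-transformed edge (conj λ)·e·λ₁ equals the associated-family edge: Im((conj λ)·e·λ₁) = (cos α·(n₁ − n) − sin α·½(n₁·n − n·n₁)) / ‖n₁ − n‖². In particular, the members of the associated family of a discrete isothermic minimal net are spin transformations, hence discretely conformally equivalent, to the original net. -/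
open scoped Quaternion

noncomputable section

/-- The spin transformation with λ = cos(α/2) − sin(α/2) n applied to the dual
edge e = (n₁ − n)/‖n₁ − n‖² produces the associated family edge
(cos α (n₁ − n) − sin α (n₁ × n))/‖n₁ − n‖², where n₁ × n = ½(n₁ n − n n₁). -/
theorem associated_family_is_spin_transformation
    (n n₁ : ℍ[ℝ]) (hn : n.re = 0) (hnu : ‖n‖ = 1)
    (hn₁ : n₁.re = 0) (hn₁u : ‖n₁‖ = 1) (hne : n ≠ n₁) (α : ℝ) :
    (star ((Real.cos (α/2) : ℍ[ℝ]) - Real.sin (α/2) • n) *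
        ((‖n₁ - n‖ ^ 2)⁻¹ • (n₁ - n)) *
        ((Real.cos (α/2) : ℍ[ℝ]) - Real.sin (α/2) • n₁)).im =
      (‖n₁ - n‖ ^ 2)⁻¹ •
        (Real.cos α • (n₁ - n) -
          Real.sin α • ((2 : ℝ)⁻¹ • (n₁ * n - n * n₁))) := by
  have h1 : n.imI ^ 2 + n.imJ ^ 2 + n.imK ^ 2 = 1 := by
    have h := Quaternion.normSq_eq_norm_mul_self n
    rw [hnu, Quaternion.normSq_def', hn] at h
    linarith
  have h2 : n₁.imI ^ 2 + n₁.imJ ^ 2 + n₁.imK ^ 2 = 1 := by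
    have h := Quaternion.normSq_eq_norm_mul_self n₁
    rw [hn₁u, Quaternion.normSq_def', hn₁] at h
    linarith
  have hc : Real.cos α = Real.cos (α/2) ^ 2 - Real.sin (α/2) ^ 2 := by
    rw [← Real.cos_two_mul']; congr 1; ring
  have hs : Real.sin α = 2 * Real.sin (α/2) * Real.cos (α/2) := by
    rw [← Real.sin_two_mul]; congr 1; ring
  rw [hc, hs, mul_smul_comm, smul_mul_assoc, Quaternion.im_smul]
  congr 1
  generalize Real.cos (α/2) = c
  generalize Real.sin (α/2) = s
  ext
  · simp [hn, hn₁]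
    right; ring
  · simp [hn, hn₁]
    linear_combination (s^2 * n.imI) * h2 - (s^2 * n₁.imI) * h1
  · simp [hn, hn₁]
    linear_combination (s^2 * n.imJ) * h2 - (s^2 * n₁.imJ) * h1
  · simp [hn, hn₁]
    linear_combination (s^2 * n.imK) * h2 - (s^2 * n₁.imK) * h1
end
end

section
/- Let U : ℝ → ℍ be a quaternion-valued function differentiable at α ∈ ℝ with U(α) ≠ 0, let 𝕜 denote the quaternion unit k, let s, t ∈ ℝ with s ≠ 0, and define the Sym–Bobenko edge X := s·U(α)⁻¹·U'(α) + t·(U(α)⁻¹·𝕜·U(α) − 𝕜) and the transported normal n₁ := U(α)⁻¹·𝕜·U(α). Then the quaternionic edge-constraint relation X·𝕜 = −n₁·X holds if and only if U'(α) anticommutes with 𝕜: U'(α)·𝕜 = −𝕜·U'(α) (equivalently, only the off-diagonal entries of the Lax matrix U depend on the spectral parameter). -/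
open scoped Quaternion

noncomputable section

/-- The quaternion unit k. -/
def qk : ℍ[ℝ] := ⟨0, 0, 0, 1⟩

/-- The Sym–Bobenko edge X = s U⁻¹ U' + t (U⁻¹ k U − k) satisfies the quaternionic
edge-constraint relation X k = −(U⁻¹ k U) X if and only if U' anticommutes
with k, i.e., only the off-diagonal entries of the Lax matrix U depend on the
spectral parameter. -/
theorem lax_pair_edge_constraint_iff
    (U : ℝ → ℍ[ℝ]) (α : ℝ) (hU : DifferentiableAt ℝ U α) (hU0 : U α ≠ 0)
    (s t : ℝ) (hs : s ≠ 0) :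
    (s • ((U α)⁻¹ * deriv U α) + t • ((U α)⁻¹ * qk * U α - qk)) * qk =
        -(((U α)⁻¹ * qk * U α) *
          (s • ((U α)⁻¹ * deriv U α) + t • ((U α)⁻¹ * qk * U α - qk))) ↔
      deriv U α * qk = -(qk * deriv U α) := by
  have hk : qk * qk = -1 := by
    have h0 : qk.re = 0 := rfl
    have h1 : qk.imI = 0 := rfl
    have h2 : qk.imJ = 0 := rfl
    have h3 : qk.imK = 1 := rfl
    ext <;> simp [Quaternion.re_mul, Quaternion.imI_mul, Quaternion.imJ_mul, Quaternion.imK_mul, h0, h1, h2, h3]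
  have hUV : U α * (U α)⁻¹ = 1 := mul_inv_cancel₀ hU0
  have hVU : (U α)⁻¹ * U α = 1 := inv_mul_cancel₀ hU0
  have hV0 : (U α)⁻¹ ≠ 0 := inv_ne_zero hU0
  generalize deriv U α = D
  generalize (U α)⁻¹ = V at *
  generalize U α = W at *
  have hn : (V * qk * W) * (V * qk * W) = -1 := by
    calc (V * qk * W) * (V * qk * W) = V * qk * (W * V) * qk * W := by noncomm_ring
      _ = V * (qk * qk) * W := by rw [hUV]; noncomm_ring
      _ = -(V * W) := by rw [hk]; noncomm_ring
      _ = -1 := by rw [hVU]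
  have hD : (V * qk * W) * (V * D) = V * (qk * D) := by
    calc (V * qk * W) * (V * D) = V * qk * (W * V) * D := by noncomm_ring
      _ = V * (qk * D) := by rw [hUV]; noncomm_ring
  have key : (s • (V * D) + t • (V * qk * W - qk)) * qk
      + (V * qk * W) * (s • (V * D) + t • (V * qk * W - qk))
      = s • (V * (D * qk + qk * D)) := by
    rw [add_mul, mul_add, smul_mul_assoc, smul_mul_assoc, mul_smul_comm, mul_smul_comm,
      sub_mul, mul_sub, hn, hk, hD, mul_add, mul_assoc V D qk]
    module
  rw [eq_neg_iff_add_eq_zero, eq_neg_iff_add_eq_zero, key]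
  simp [hs, hV0]
end
end
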